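/- Let r > 0, κ ∈ (0,1), and let ω : (0, r] → [0, ∞) be bounded. Suppose there are constants c₁, c₂ > 0 such that c₁ ω(t) ≤ ω(s) ≤ c₂ ω(t) whenever κt ≤ s ≤ t and 0 < t ≤ r. Then ∑_{i=0}^∞ ω(κ^i r) ≤ C ∫₀^r ω(t)/t dt, where C depends only on c₁, c₂ and κ. -/

import Mathlib

open MeasureTheory Set

/-- A function bounded below by `c` times its value at `b` on `(a, b]` has logarithmic integral over
`(a, b]` at least `c (1 - a / b)` times that value. -/
theorem ofReal_mul_le_setLIntegral_div {a b c : ℝ} (ha : 0 ≤ a) (hab : a < b) (f : ℝ → ℝ)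
    (hf : 0 ≤ c * f b) (h : ∀ t ∈ Set.Ioc a b, c * f b ≤ f t) :
    ENNReal.ofReal (c * f b * (1 - a / b)) ≤ ∫⁻ t in Set.Ioc a b, ENNReal.ofReal (f t / t) := by
  have hb : 0 < b := ha.trans_lt hab
  calc ENNReal.ofReal (c * f b * (1 - a / b))
      = ENNReal.ofReal (c * f b / b) * volume (Set.Ioc a b) := by
        rw [Real.volume_Ioc, ← ENNReal.ofReal_mul (by positivity)]
        congr 1
        field_simp
    _ = ∫⁻ _ in Set.Ioc a b, ENNReal.ofReal (c * f b / b) := (setLIntegral_const _ _).symm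
    _ ≤ ∫⁻ t in Set.Ioc a b, ENNReal.ofReal (f t / t) := by
        refine setLIntegral_mono' measurableSet_Ioc fun t ht => ENNReal.ofReal_le_ofReal ?_
        exact div_le_div₀ (hf.trans (h t ht)) (h t ht) (ha.trans_lt ht.1) ht.2

/-- If a nonnegative bounded function `ω` on `(0,r]` satisfies the doubling-type comparison
`c₁ ω(t) ≤ ω(s) ≤ c₂ ω(t)` whenever `κ t ≤ s ≤ t ≤ r`, then
`∑_{i=0}^∞ ω(κ^i r) ≤ C ∫₀^r ω(t)/t dt`, where `C` depends only on `c₁`, `c₂` and `κ`. -/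
theorem dini_sum_le_integral
    (κ c₁ c₂ : ℝ) (hκ : κ ∈ Set.Ioo (0:ℝ) 1) (hc₁ : 0 < c₁) (hc₂ : 0 < c₂) :
    ∃ C : ℝ, 0 < C ∧
      ∀ r : ℝ, 0 < r →
      ∀ ω : ℝ → ℝ,
        (∀ t ∈ Set.Ioc (0:ℝ) r, 0 ≤ ω t) →
        (∃ M : ℝ, ∀ t ∈ Set.Ioc (0:ℝ) r, ω t ≤ M) →
        (∀ s t : ℝ, 0 < t → t ≤ r → κ * t ≤ s → s ≤ t → c₁ * ω t ≤ ω s ∧ ω s ≤ c₂ * ω t) →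
        ∑' i : ℕ, ENNReal.ofReal (ω (κ ^ i * r))
          ≤ ENNReal.ofReal C * ∫⁻ t in Set.Ioc (0:ℝ) r, ENNReal.ofReal (ω t / t) := by
  obtain ⟨hκ0, hκ1⟩ := hκ
  have hκ' : 0 < 1 - κ := sub_pos.2 hκ1
  refine ⟨(c₁ * (1 - κ))⁻¹, by positivity, fun r hr ω hω _ hcomp => ?_⟩
  have hanti : Antitone fun i : ℕ => κ ^ i * r := fun i j hij =>
    mul_le_mul_of_nonneg_right (pow_le_pow_of_le_one hκ0.le hκ1.le hij) hr.le
  have hdisj : Pairwise (Function.onFun Disjoint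
      fun i : ℕ => Set.Ioc (κ ^ (i + 1) * r) (κ ^ i * r)) :=
    hanti.pairwise_disjoint_on_Ioc_succ
  have hle : ∀ i : ℕ, κ ^ i * r ≤ r := fun i =>
    mul_le_of_le_one_left hr.le (pow_le_one₀ hκ0.le hκ1.le)
  have hterm : ∀ i : ℕ, ENNReal.ofReal (ω (κ ^ i * r)) ≤ ENNReal.ofReal (c₁ * (1 - κ))⁻¹ *
      ∫⁻ t in Set.Ioc (κ ^ (i + 1) * r) (κ ^ i * r), ENNReal.ofReal (ω t / t) := by
    intro i
    have hpos : 0 < κ ^ i * r := by positivity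
    have hsucc : κ ^ (i + 1) * r = κ * (κ ^ i * r) := by ring
    have hnonneg : 0 ≤ ω (κ ^ i * r) := hω _ ⟨hpos, hle i⟩
    rw [hsucc]
    have hint := ofReal_mul_le_setLIntegral_div (c := c₁) (by positivity)
      (mul_lt_of_lt_one_left hpos hκ1) ω (by positivity)
      fun t ht => (hcomp t (κ ^ i * r) hpos (hle i) ht.1.le ht.2).1
    rw [mul_div_cancel_right₀ κ hpos.ne'] at hint
    calc ENNReal.ofReal (ω (κ ^ i * r))
        = ENNReal.ofReal (c₁ * (1 - κ))⁻¹ *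
            ENNReal.ofReal (c₁ * ω (κ ^ i * r) * (1 - κ)) := by
          rw [← ENNReal.ofReal_mul (by positivity)]
          congr 1
          field_simp
      _ ≤ _ := by gcongr
  calc ∑' i : ℕ, ENNReal.ofReal (ω (κ ^ i * r))
      ≤ ∑' i : ℕ, ENNReal.ofReal (c₁ * (1 - κ))⁻¹ *
          ∫⁻ t in Set.Ioc (κ ^ (i + 1) * r) (κ ^ i * r), ENNReal.ofReal (ω t / t) :=
        ENNReal.tsum_le_tsum hterm
    _ = ENNReal.ofReal (c₁ * (1 - κ))⁻¹ *
          ∫⁻ t in ⋃ i : ℕ, Set.Ioc (κ ^ (i + 1) * r) (κ ^ i * r), ENNReal.ofReal (ω t / t) := by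
        rw [ENNReal.tsum_mul_left, lintegral_iUnion (fun _ => measurableSet_Ioc) hdisj]
    _ ≤ ENNReal.ofReal (c₁ * (1 - κ))⁻¹ *
          ∫⁻ t in Set.Ioc (0:ℝ) r, ENNReal.ofReal (ω t / t) := by
        gcongr
        exact Set.iUnion_subset fun i => Set.Ioc_subset_Ioc (by positivity) (hle i)
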